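/- arXiv:math/0412535 — 2 statements merged into one kernel-verified Lean document; each statement's English description precedes it below -/
import Mathlib

section
/- Let G be a finite simple graph, W a subset of its vertex set, and H the induced subgraph of G on W. If the cut polytope Cut(G) is compressed, then the cut polytope Cut(H) is compressed. (Lemma 3.4 of the paper.) -/
noncomputable section

/-- The unit hypercube `[0,1]^N ⊆ ℝ^N`. -/
def stdCube (N : ℕ) : Set (Fin N → ℝ) := {x | ∀ i, x i ∈ Set.Icc (0 : ℝ) 1}

/-- The set of `0/1` points `{0,1}^N ⊆ ℝ^N`. -/
def zeroOneSet (N : ℕ) : Set (Fin N → ℝ) := {x | ∀ i, x i = 0 ∨ x i = 1}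

/-- A polytope presented as the convex hull of a finite set `A` of integer points in `ℝ^E`
is compressed (characterization (3) of the paper's Theorem 2.4): there are `N ∈ ℕ` and an
affine map `π : ℝ^E → ℝ^N`, injective on `conv A`, mapping every point of `conv A` lying in
the subgroup of `ℤ^E` generated by `A` into `{0,1}^N`, with
`π(conv A) = [0,1]^N ∩ affineSpan ℝ (π(conv A))`. -/
def IsCompressed {E : Type*} (A : Set (E → ℝ)) : Prop :=
  ∃ (N : ℕ) (π : (E → ℝ) →ᵃ[ℝ] (Fin N → ℝ)),
    Set.InjOn π (convexHull ℝ A) ∧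
    (∀ x ∈ convexHull ℝ A ∩ (AddSubgroup.closure A : Set (E → ℝ)), π x ∈ zeroOneSet N) ∧
    π '' convexHull ℝ A
      = stdCube N ∩ (affineSpan ℝ (π '' convexHull ℝ A) : Set (Fin N → ℝ))

open Classical in
/-- The cut semimetric `δ_G(S) ∈ ℝ^E` of a subset `S` of the vertices of `G`: the coordinate
at an edge is `1` if exactly one of its endpoints lies in `S`, and `0` otherwise. -/
noncomputable def cutVec {V : Type*} (G : SimpleGraph V) (S : Set V) : G.edgeSet → ℝ :=
  fun e =>
    if Sym2.lift ⟨fun u v => ((u ∈ S) ↔ (v ∈ S)), fun _ _ => propext iff_comm⟩ e.1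
    then 0 else 1

theorem cutVec_mk {V : Type*} (G : SimpleGraph V) (S : Set V) {u v : V} (h : s(u, v) ∈ G.edgeSet)
    [Decidable (u ∈ S ↔ v ∈ S)] :
    cutVec G S ⟨s(u, v), h⟩ = if (u ∈ S ↔ v ∈ S) then 0 else 1 := by
  simp only [cutVec, Sym2.lift_mk]
  congr

theorem cutVec_eq_zero_or_one {V : Type*} (G : SimpleGraph V) (S : Set V) (e : G.edgeSet) :
    cutVec G S e = 0 ∨ cutVec G S e = 1 := by
  unfold cutVec
  split_ifs <;> simp

theorem cutVec_symmDiff_of_mem {V : Type*} (G : SimpleGraph V) (S : Set V) {v : V} {e : G.edgeSet}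
    (hv : v ∈ e.1) : cutVec G (symmDiff S {v}) e = 1 - cutVec G S e := by
  classical
  obtain ⟨e, he⟩ := e
  obtain ⟨w, rfl⟩ := hv
  have hne : w ≠ v := (G.ne_of_adj he).symm
  rw [cutVec_mk, cutVec_mk]
  by_cases h1 : v ∈ S <;> by_cases h2 : w ∈ S <;> simp [Set.mem_symmDiff, h1, h2, hne]

theorem cutVec_symmDiff_of_notMem {V : Type*} (G : SimpleGraph V) (S : Set V) {v : V}
    {e : G.edgeSet} (hv : v ∉ e.1) : cutVec G (symmDiff S {v}) e = cutVec G S e := by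
  classical
  obtain ⟨e, he⟩ := e
  induction e using Sym2.ind with
  | _ a b =>
    have ha : a ≠ v := by rintro rfl; exact hv (Sym2.mem_mk_left _ _)
    have hb : b ≠ v := by rintro rfl; exact hv (Sym2.mem_mk_right _ _)
    rw [cutVec_mk, cutVec_mk]
    simp [Set.mem_symmDiff, ha, hb]

theorem cutVec_empty {V : Type*} (G : SimpleGraph V) : cutVec G ∅ = 0 := by
  classical
  funext ⟨e, he⟩
  induction e using Sym2.ind with
  | _ a b => simp [cutVec_mk]

/-- A multiple of every coordinate vector is an alternating sum of four cut semimetrics. -/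
theorem exists_alternating_sum_cutVec {V : Type*} (G : SimpleGraph V) [DecidableEq G.edgeSet]
    (e : G.edgeSet) : ∃ A B C D : Set V,
      cutVec G A + cutVec G B - cutVec G C - cutVec G D = Pi.single e 2 := by
  obtain ⟨e, he⟩ := e
  induction e using Sym2.ind with
  | _ a b =>
    have hab : a ≠ b := G.ne_of_adj he
    refine ⟨symmDiff ∅ {a}, symmDiff ∅ {b}, ∅, symmDiff (symmDiff ∅ {a}) {b}, ?_⟩
    funext e'
    simp only [Pi.add_apply, Pi.sub_apply]
    by_cases ha : a ∈ e'.1 <;> by_cases hb : b ∈ e'.1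
    · have : e' = ⟨s(a, b), he⟩ := Subtype.ext ((Sym2.mem_and_mem_iff hab).1 ⟨ha, hb⟩)
      subst this
      rw [cutVec_symmDiff_of_mem G _ hb, cutVec_symmDiff_of_mem G _ hb,
        cutVec_symmDiff_of_mem G _ ha, cutVec_empty]
      norm_num
    all_goals
      have : e' ≠ ⟨s(a, b), he⟩ := by rintro rfl; simp at ha hb
      simp [this, cutVec_symmDiff_of_mem, cutVec_symmDiff_of_notMem, ha, hb, cutVec_empty]

theorem affineSpan_range_cutVec {V : Type*} (G : SimpleGraph V) [Finite G.edgeSet] :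
    affineSpan ℝ (Set.range (cutVec G)) = ⊤ := by
  classical
  have := Fintype.ofFinite G.edgeSet
  rw [AffineSubspace.affineSpan_eq_top_iff_vectorSpan_eq_top_of_nonempty _ _ _
    (Set.range_nonempty _), eq_top_iff]
  intro x _
  rw [pi_eq_sum_univ x]
  refine Submodule.sum_mem _ fun e _ => Submodule.smul_mem _ _ ?_
  obtain ⟨A, B, C, D, h⟩ := exists_alternating_sum_cutVec G e
  have h2 : (fun j => if e = j then (1 : ℝ) else 0)
      = (1 / 2 : ℝ) • ((cutVec G A -ᵥ cutVec G C) + (cutVec G B -ᵥ cutVec G D)) := by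
    have : (cutVec G A -ᵥ cutVec G C) + (cutVec G B -ᵥ cutVec G D) = Pi.single e 2 := by
      rw [← h]; simp only [vsub_eq_sub]; abel
    rw [this]
    funext j
    by_cases hj : e = j
    · subst hj; simp
    · simp [hj, Ne.symm hj]
  rw [h2]
  exact Submodule.smul_mem _ _ (Submodule.add_mem _
    (vsub_mem_vectorSpan ℝ ⟨A, rfl⟩ ⟨C, rfl⟩) (vsub_mem_vectorSpan ℝ ⟨B, rfl⟩ ⟨D, rfl⟩))

/-- An affine map that is injective on a convex set with nonempty interior is injective. -/
theorem AffineMap.injective_of_injOn_of_interior_nonempty {E F : Type*} [AddCommGroup E]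
    [Module ℝ E] [TopologicalSpace E] [IsTopologicalAddGroup E] [ContinuousSMul ℝ E]
    [AddCommGroup F] [Module ℝ F] (f : E →ᵃ[ℝ] F) {s : Set E} (hs : (interior s).Nonempty)
    (hf : Set.InjOn f s) : Function.Injective f := by
  intro x y hxy
  obtain ⟨z, hz⟩ := hs
  have hc : Filter.Tendsto (fun t : ℝ => z + t • (x - y)) (nhdsWithin 0 (Set.Ioi 0)) (nhds z) := by
    have : Continuous (fun t : ℝ => z + t • (x - y)) := by fun_prop
    simpa using (this.tendsto 0).mono_left nhdsWithin_le_nhds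
  obtain ⟨t, ht, ht0⟩ := ((hc.eventually (mem_interior_iff_mem_nhds.1 hz)).and
    self_mem_nhdsWithin).exists
  have hlin : f.linear (x - y) = 0 := by
    have := f.linearMap_vsub x y
    simpa [hxy] using this
  have himg : f (z + t • (x - y)) = f z := by
    have := f.map_vadd z (t • (x - y))
    simpa [hlin, add_comm] using this
  have h0 := hf ht (interior_subset hz) himg
  have h1 : t • (x - y) = 0 := by simpa using h0
  exact sub_eq_zero.1 ((smul_eq_zero.1 h1).resolve_left (ne_of_gt ht0))

/-- The sign vector of an edge is orthogonal to the constants. -/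
theorem sum_sign_cutVec {V : Type*} (G : SimpleGraph V)
    [Fintype (Set V)] (e : G.edgeSet) : ∑ S : Set V, (1 - 2 * cutVec G S e) = 0 := by
  obtain ⟨v, hv⟩ : ∃ v, v ∈ e.1 := ⟨_, Sym2.out_fst_mem e.1⟩
  have h := Equiv.sum_comp (Function.Involutive.toPerm (fun S : Set V => symmDiff S {v})
    (symmDiff_left_involutive {v})) (fun S => (1 - 2 * cutVec G S e))
  simp only [Function.Involutive.coe_toPerm, cutVec_symmDiff_of_mem G _ hv] at h
  have h2 : ∑ S : Set V, (1 - 2 * (1 - cutVec G S e)) = - ∑ S : Set V, (1 - 2 * cutVec G S e) := by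
    rw [← Finset.sum_neg_distrib]
    exact Finset.sum_congr rfl fun _ _ => by ring
  linarith

/-- The sign vectors of distinct edges are orthogonal. -/
theorem sum_sign_cutVec_mul {V : Type*} (G : SimpleGraph V)
    [Fintype (Set V)] {e e' : G.edgeSet} (hne : e ≠ e') :
    ∑ S : Set V, (1 - 2 * cutVec G S e) * (1 - 2 * cutVec G S e') = 0 := by
  obtain ⟨v, hv, hv'⟩ : ∃ v, v ∈ e.1 ∧ v ∉ e'.1 := by
    by_contra! hcon
    obtain ⟨e, he⟩ := e
    induction e using Sym2.ind with
    | _ a b =>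
      exact hne (Subtype.ext ((Sym2.mem_and_mem_iff (G.ne_of_adj he)).1
        ⟨hcon a (Sym2.mem_mk_left _ _), hcon b (Sym2.mem_mk_right _ _)⟩).symm)
  have h := Equiv.sum_comp (Function.Involutive.toPerm (fun S : Set V => symmDiff S {v})
    (symmDiff_left_involutive {v}))
    (fun S => (1 - 2 * cutVec G S e) * (1 - 2 * cutVec G S e'))
  simp only [Function.Involutive.coe_toPerm, cutVec_symmDiff_of_mem G _ hv,
    cutVec_symmDiff_of_notMem G _ hv'] at h
  have h2 : ∑ S : Set V, (1 - 2 * (1 - cutVec G S e)) * (1 - 2 * cutVec G S e')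
      = - ∑ S : Set V, (1 - 2 * cutVec G S e) * (1 - 2 * cutVec G S e') := by
    rw [← Finset.sum_neg_distrib]
    exact Finset.sum_congr rfl fun _ _ => by ring
  linarith

/-- Parseval's identity for affine functions of the cut semimetric. -/
theorem sum_sq_affine_sign_cutVec {V : Type*} (G : SimpleGraph V)
    [Fintype (Set V)] [Fintype G.edgeSet] (a : ℝ) (k : G.edgeSet → ℝ) :
    ∑ S : Set V, (a + ∑ e, k e * (1 - 2 * cutVec G S e)) ^ 2
      = Fintype.card (Set V) * (a ^ 2 + ∑ e, k e ^ 2) := by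
  classical
  have hcross : ∑ S : Set V, ∑ e, k e * (1 - 2 * cutVec G S e) = 0 := by
    rw [Finset.sum_comm]
    simp only [← Finset.mul_sum, sum_sign_cutVec, mul_zero, Finset.sum_const_zero]
  have hsq : ∑ S : Set V, (∑ e, k e * (1 - 2 * cutVec G S e)) ^ 2
      = Fintype.card (Set V) * ∑ e, k e ^ 2 := by
    simp only [sq, Finset.sum_mul_sum]
    rw [Finset.sum_comm, Finset.mul_sum]
    refine Finset.sum_congr rfl fun e _ => ?_
    rw [Finset.sum_comm, Finset.sum_eq_single e]
    · rw [Finset.sum_congr rfl (g := fun _ => k e * k e), Finset.sum_const, Finset.card_univ,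
        nsmul_eq_mul]
      intro S _
      rcases cutVec_eq_zero_or_one G S e with h | h <;> rw [h] <;> ring
    · intro e' _ hne
      rw [Finset.sum_congr rfl (g := fun S => (k e * k e') *
        ((1 - 2 * cutVec G S e) * (1 - 2 * cutVec G S e'))) fun S _ => by ring,
        ← Finset.mul_sum, sum_sign_cutVec_mul G hne.symm, mul_zero]
    · simp
  calc _ = ∑ S : Set V, (a ^ 2 + 2 * a * (∑ e, k e * (1 - 2 * cutVec G S e))
        + (∑ e, k e * (1 - 2 * cutVec G S e)) ^ 2) :=
        Finset.sum_congr rfl fun _ _ => by ring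
    _ = _ := by
      rw [Finset.sum_add_distrib, Finset.sum_add_distrib, ← Finset.mul_sum, hcross, hsq,
        Finset.sum_const, Finset.card_univ, nsmul_eq_mul]
      ring

/-- If an affine function takes only the values `0` and `1` on the cut semimetrics of `G` and
depends on some edge at the vertex `v`, then it maps into `[0,1]` every point of the unit cube
whose coordinates at the edges through `v` equal `1/2`. -/
theorem affine_mem_Icc_of_half_at_vertex {V : Type*} [Fintype V] (G : SimpleGraph V)
    [Fintype G.edgeSet] (a : ℝ) (c : G.edgeSet → ℝ)
    (h01 : ∀ S, a + ∑ e, c e * cutVec G S e = 0 ∨ a + ∑ e, c e * cutVec G S e = 1)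
    {v : V} {e₀ : G.edgeSet} (hv : v ∈ e₀.1) (hc : c e₀ ≠ 0) {y : G.edgeSet → ℝ}
    (hy : ∀ e, y e ∈ Set.Icc (0 : ℝ) 1) (hyv : ∀ e : G.edgeSet, v ∈ e.1 → y e = 1 / 2) :
    a + ∑ e, c e * y e ∈ Set.Icc (0 : ℝ) 1 := by
  classical
  have hint : ∀ S, ∃ n : ℤ, a + ∑ e, c e * cutVec G S e = n := fun S => by
    rcases h01 S with h | h
    · exact ⟨0, by simp [h]⟩
    · exact ⟨1, by simp [h]⟩
  have hk : ∀ e, ∃ n : ℤ, 2 * c e = n := by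
    intro e
    obtain ⟨A, B, C, D, h⟩ := exists_alternating_sum_cutVec G e
    obtain ⟨nA, hA⟩ := hint A
    obtain ⟨nB, hB⟩ := hint B
    obtain ⟨nC, hC⟩ := hint C
    obtain ⟨nD, hD⟩ := hint D
    refine ⟨nA + nB - nC - nD, ?_⟩
    push_cast
    rw [← hA, ← hB, ← hC, ← hD]
    have : ∑ e', c e' * (cutVec G A + cutVec G B - cutVec G C - cutVec G D) e' = c e * 2 := by
      rw [h]; simp [Pi.single_apply]
    simp only [Pi.add_apply, Pi.sub_apply, mul_add, mul_sub, Finset.sum_add_distrib,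
      Finset.sum_sub_distrib] at this
    linarith
  choose k hk using hk
  obtain ⟨n₀, hn₀⟩ := hint ∅
  have ha : a = n₀ := by simpa [cutVec_empty] using hn₀
  have hform : ∀ x : G.edgeSet → ℝ, 4 * (a + ∑ e, c e * x e) - 2
      = ((4 * n₀ - 2 + ∑ e, k e : ℤ) : ℝ) + ∑ e, (-(k e : ℝ)) * (1 - 2 * x e) := by
    intro x
    push_cast
    rw [add_assoc, ← Finset.sum_add_distrib, mul_add, ha, Finset.mul_sum, add_sub_right_comm]
    congr 1
    exact Finset.sum_congr rfl fun e _ => by rw [← hk e]; ring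
  set k₀ : ℤ := 4 * n₀ - 2 + ∑ e, k e
  have hpars : k₀ ^ 2 + ∑ e, k e ^ 2 = 4 := by
    have h := sum_sq_affine_sign_cutVec G (k₀ : ℝ) (fun e => -(k e : ℝ))
    rw [Finset.sum_congr rfl (g := fun _ => (4 : ℝ)), Finset.sum_const, Finset.card_univ,
      nsmul_eq_mul] at h
    · have hpos : (Fintype.card (Set V) : ℝ) ≠ 0 := by simp
      have h' := mul_left_cancel₀ hpos h
      simp only [neg_sq] at h'
      exact_mod_cast h'.symm
    · intro S _
      rw [← hform]
      rcases h01 S with h | h <;> rw [h] <;> norm_num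
  have hsplit := fun f : G.edgeSet → ℤ =>
    Finset.sum_filter_add_sum_filter_not Finset.univ (fun e : G.edgeSet => v ∈ e.1) f
  have hpar : Even (∑ e with v ∈ Subtype.val e, k e) := by
    obtain ⟨n, hn⟩ := hint (symmDiff ∅ {v})
    refine even_iff_two_dvd.2 ⟨n - n₀, ?_⟩
    have h1 : ∑ e, c e * cutVec G (symmDiff ∅ {v}) e = ∑ e with v ∈ Subtype.val e, c e := by
      rw [Finset.sum_filter]
      refine Finset.sum_congr rfl fun e _ => ?_
      split_ifs with h
      · rw [cutVec_symmDiff_of_mem G _ h, cutVec_empty]; simp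
      · rw [cutVec_symmDiff_of_notMem G _ h, cutVec_empty]; simp
    have h2 : ((∑ e with v ∈ Subtype.val e, k e : ℤ) : ℝ) = 2 * (n - n₀) := by
      push_cast
      rw [← hn, ← ha, h1]
      simp only [← hk, ← Finset.mul_sum]
      ring
    exact_mod_cast h2
  have hpar2 : Even (∑ e with v ∈ Subtype.val e, k e ^ 2) := by
    have : ∀ s : Finset G.edgeSet, Even (∑ e ∈ s, k e ^ 2) ↔ Even (∑ e ∈ s, k e) := by
      intro s
      induction s using Finset.induction_on with
      | empty => simp
      | insert e s he ih =>
        rw [Finset.sum_insert he, Finset.sum_insert he]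
        simp [Int.even_add, ih, Int.even_pow]
    exact (this _).2 hpar
  have hpos : 0 < ∑ e with v ∈ Subtype.val e, k e ^ 2 := by
    refine Finset.sum_pos' (fun _ _ => sq_nonneg _) ⟨e₀, by simpa using hv, ?_⟩
    have : k e₀ ≠ 0 := by
      intro h0
      have := hk e₀
      rw [h0] at this
      exact hc (by simpa using this)
    positivity
  have htwo : 2 ≤ ∑ e with v ∈ Subtype.val e, k e ^ 2 := by
    obtain ⟨m, hm⟩ := hpar2
    omega
  have habs : ∀ n : ℤ, |n| ≤ n ^ 2 := fun n => by
    rw [← sq_abs]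
    exact Int.le_self_sq _
  have hle : |k₀| + ∑ e with ¬ v ∈ Subtype.val e, |k e| ≤ 2 := by
    have h1 := Finset.sum_le_sum fun e (_ : e ∈ Finset.univ.filter
      fun e : G.edgeSet => ¬ v ∈ e.1) => habs (k e)
    have h2 := hsplit fun e => k e ^ 2
    have h3 := habs k₀
    linarith
  have hbound : |4 * (a + ∑ e, c e * y e) - 2| ≤ 2 := by
    rw [hform]
    have h1 : ∑ e, (-(k e : ℝ)) * (1 - 2 * y e)
        = ∑ e with ¬ v ∈ Subtype.val e, (-(k e : ℝ)) * (1 - 2 * y e) := by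
      rw [Finset.sum_filter]
      refine Finset.sum_congr rfl fun e _ => ?_
      split_ifs with h
      · rw [hyv e h]; norm_num
      · rfl
    rw [h1]
    refine (abs_add_le _ _).trans (le_trans (add_le_add_right ((Finset.abs_sum_le_sum_abs _ _).trans
      (Finset.sum_le_sum (g := fun e => |(k e : ℝ)|) fun e _ => ?_)) _) ?_)
    · rw [abs_mul, abs_neg]
      refine mul_le_of_le_one_right (abs_nonneg _) (abs_le.2 ?_)
      have := hy e
      constructor <;> linarith [this.1, this.2]
    · exact_mod_cast hle
  rw [abs_le] at hbound
  constructor <;> linarith [hbound.1, hbound.2]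

theorem convexHull_subset_pi_Icc {E : Type*} {A : Set (E → ℝ)}
    (hA : ∀ x ∈ A, ∀ e, x e = 0 ∨ x e = 1) :
    convexHull ℝ A ⊆ Set.pi Set.univ fun _ => Set.Icc (0 : ℝ) 1 := by
  refine convexHull_min (fun y hy e _ => ?_) (convex_pi fun _ _ => convex_Icc 0 1)
  rcases hA y hy e with h | h <;> simp [h]

theorem mem_of_mem_convexHull_of_zeroOne {E : Type*} {A : Set (E → ℝ)}
    (hA : ∀ x ∈ A, ∀ e, x e = 0 ∨ x e = 1) {x : E → ℝ} (hx : x ∈ convexHull ℝ A)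
    (hx01 : ∀ e, x e = 0 ∨ x e = 1) : x ∈ A := by
  refine extremePoints_convexHull_subset
    (inter_extremePoints_subset_extremePoints_of_subset (𝕜 := ℝ)
      (convexHull_subset_pi_Icc hA) ⟨hx, ?_⟩)
  rw [extremePoints_pi]
  intro e _
  refine mem_extremePoints_iff_left.2 ⟨?_, ?_⟩
  · rcases hx01 e with h | h <;> simp [h]
  · rintro a ha b hb ⟨s, t, hs, ht, hst, h⟩
    simp only [smul_eq_mul] at h
    rcases hx01 e with h' | h' <;> rw [h'] at h ⊢
    · nlinarith [ha.1, mul_nonneg ht.le hb.1, mul_nonneg hs.le ha.1]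
    · nlinarith [ha.2, mul_nonneg ht.le (sub_nonneg.2 hb.2), mul_nonneg hs.le (sub_nonneg.2 ha.2)]

theorem mem_of_mem_convexHull_of_mem_closure {E : Type*} {A : Set (E → ℝ)}
    (hA : ∀ x ∈ A, ∀ e, x e = 0 ∨ x e = 1) {x : E → ℝ} (hx : x ∈ convexHull ℝ A)
    (hxA : x ∈ AddSubgroup.closure A) : x ∈ A := by
  have hint : ∀ e, ∃ n : ℤ, x e = n := by
    clear hx
    intro e
    induction hxA using AddSubgroup.closure_induction with
    | mem x hx =>
      rcases hA x hx e with h | h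
      · exact ⟨0, by simp [h]⟩
      · exact ⟨1, by simp [h]⟩
    | zero => exact ⟨0, by simp⟩
    | add x y _ _ hx hy =>
      obtain ⟨m, hm⟩ := hx
      obtain ⟨n, hn⟩ := hy
      exact ⟨m + n, by simp [hm, hn]⟩
    | neg x _ hx =>
      obtain ⟨m, hm⟩ := hx
      exact ⟨-m, by simp [hm]⟩
  refine mem_of_mem_convexHull_of_zeroOne hA hx fun e => ?_
  obtain ⟨n, hn⟩ := hint e
  have hmem := convexHull_subset_pi_Icc hA hx e trivial
  simp only [hn, Set.mem_Icc] at hmem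
  have h0 : 0 ≤ n := by exact_mod_cast hmem.1
  have h1 : n ≤ 1 := by exact_mod_cast hmem.2
  rw [hn]
  interval_cases n <;> simp

/-- The edge of `G` given by an edge of an induced subgraph. -/
def induceEdge {V : Type*} (G : SimpleGraph V) (W : Set V) (e : (G.induce W).edgeSet) :
    G.edgeSet :=
  ⟨Sym2.map Subtype.val e.1, by
    obtain ⟨e, he⟩ := e
    induction e using Sym2.ind with
    | _ a b => exact he⟩

theorem induceEdge_injective {V : Type*} (G : SimpleGraph V) (W : Set V) :
    Function.Injective (induceEdge G W) := fun _ _ h =>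
  Subtype.ext (Sym2.map.injective Subtype.val_injective (congrArg Subtype.val h))

theorem exists_mem_notMem_of_notMem_range_induceEdge {V : Type*} (G : SimpleGraph V) (W : Set V)
    {e : G.edgeSet} (he : e ∉ Set.range (induceEdge G W)) : ∃ v ∈ e.1, v ∉ W := by
  by_contra! hcon
  obtain ⟨e, h⟩ := e
  induction e using Sym2.ind with
  | _ a b =>
    exact he ⟨⟨s(⟨a, hcon a (Sym2.mem_mk_left _ _)⟩, ⟨b, hcon b (Sym2.mem_mk_right _ _)⟩), h⟩, rfl⟩

theorem notMem_range_induceEdge {V : Type*} (G : SimpleGraph V) (W : Set V)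
    {e : G.edgeSet} {v : V} (hv : v ∈ e.1) (hW : v ∉ W) : e ∉ Set.range (induceEdge G W) := by
  rintro ⟨e', rfl⟩
  obtain ⟨w, _, rfl⟩ := Sym2.mem_map.1 hv
  exact hW w.2

theorem cutVec_induceEdge {V : Type*} (G : SimpleGraph V) (W S : Set V)
    (e : (G.induce W).edgeSet) :
    cutVec G S (induceEdge G W e) = cutVec (G.induce W) (Subtype.val ⁻¹' S) e := by
  classical
  obtain ⟨e, he⟩ := e
  induction e using Sym2.ind with
  | _ a b =>
    rw [cutVec_mk]
    exact cutVec_mk G S _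

/-- The affine section of the restriction of coordinates to the edges of an induced subgraph
that fills the remaining coordinates with `1/2`. -/
def extendByHalf {V : Type*} (G : SimpleGraph V) (W : Set V) :
    ((G.induce W).edgeSet → ℝ) →ᵃ[ℝ] (G.edgeSet → ℝ) :=
  (Function.ExtendByZero.linearMap ℝ (induceEdge G W)).toAffineMap +
    AffineMap.const ℝ _ (Function.extend (induceEdge G W) (fun _ => 0) fun _ => 1 / 2)

theorem extendByHalf_induceEdge {V : Type*} (G : SimpleGraph V) (W : Set V)
    (x : (G.induce W).edgeSet → ℝ) (e : (G.induce W).edgeSet) :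
    extendByHalf G W x (induceEdge G W e) = x e := by
  simp [extendByHalf, (induceEdge_injective G W).extend_apply]

theorem extendByHalf_of_notMem {V : Type*} (G : SimpleGraph V) (W : Set V)
    (x : (G.induce W).edgeSet → ℝ) {e : G.edgeSet} (he : e ∉ Set.range (induceEdge G W)) :
    extendByHalf G W x e = 1 / 2 := by
  have he' : ¬ ∃ a, induceEdge G W a = e := he
  simp [extendByHalf, Function.extend_apply' _ _ _ he']

/-- A finite family of affine functions that contains the coordinates, takes only the values `0`
and `1` on a set `A` of `0/1` points, and cuts out the convex hull of `A` witnesses that this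
convex hull is compressed. -/
theorem isCompressed_of_affine_family {E ι : Type*} [Finite E] [Finite ι] {A : Set (E → ℝ)}
    (hA : ∀ x ∈ A, ∀ e, x e = 0 ∨ x e = 1) (f : ι → (E → ℝ) →ᵃ[ℝ] ℝ)
    (hf : ∀ i, ∀ x ∈ A, f i x = 0 ∨ f i x = 1)
    (h : ∀ x : E → ℝ, (∀ e, x e ∈ Set.Icc (0 : ℝ) 1) → (∀ i, f i x ∈ Set.Icc (0 : ℝ) 1) →
      x ∈ convexHull ℝ A) : IsCompressed A := by
  obtain ⟨N, ⟨φ⟩⟩ := Finite.exists_equiv_fin (E ⊕ ι)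
  let F : E ⊕ ι → (E → ℝ) →ᵃ[ℝ] ℝ :=
    Sum.elim (fun e => (LinearMap.proj (R := ℝ) (φ := fun _ : E => ℝ) e).toAffineMap) f
  have hF : ∀ j, ∀ x ∈ A, F j x = 0 ∨ F j x = 1 := by
    rintro (e | i) x hx
    · exact hA x hx e
    · exact hf i x hx
  let π : (E → ℝ) →ᵃ[ℝ] (Fin N → ℝ) := AffineMap.pi fun j => F (φ.symm j)
  have hπ : ∀ x j, π x (φ j) = F j x := fun x j => by simp [π]
  have hcube : π '' convexHull ℝ A ⊆ stdCube N := by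
    have hconv : Convex ℝ (stdCube N) := by
      have : stdCube N = Set.pi Set.univ fun _ => Set.Icc (0 : ℝ) 1 := by
        ext; simp only [stdCube, Set.mem_ofPred_eq, Set.mem_univ_pi]
      rw [this]
      exact convex_pi fun _ _ => convex_Icc 0 1
    rw [AffineMap.image_convexHull]
    refine convexHull_min ?_ hconv
    rintro _ ⟨x, hx, rfl⟩ j
    rcases hF (φ.symm j) x hx with h | h <;> simp [π, h]
  refine ⟨N, π, ?_, ?_, ?_⟩
  · intro x _ y _ hxy
    funext e
    have := congrFun hxy (φ (Sum.inl e))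
    rwa [hπ, hπ] at this
  · rintro x ⟨hx, hxA⟩ j
    exact hF _ x (mem_of_mem_convexHull_of_mem_closure hA hx hxA)
  · refine Set.Subset.antisymm (Set.subset_inter hcube (subset_affineSpan ℝ _)) ?_
    rintro y ⟨hy, hyA⟩
    rw [← AffineSubspace.map_span] at hyA
    obtain ⟨x, -, rfl⟩ := hyA
    refine ⟨x, h x (fun e => ?_) (fun i => ?_), rfl⟩
    · have := hy (φ (Sum.inl e))
      rwa [hπ] at this
    · have := hy (φ (Sum.inr i))
      rwa [hπ] at this

theorem AffineMap.apply_eq_sum_pi {E : Type*} [Fintype E] [DecidableEq E]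
    (f : (E → ℝ) →ᵃ[ℝ] ℝ) (x : E → ℝ) :
    f x = f 0 + ∑ e, f.linear (Pi.single e 1) * x e := by
  have h := f.map_vadd 0 x
  rw [vadd_eq_add, add_zero, vadd_eq_add] at h
  rw [h, LinearMap.pi_apply_eq_sum_univ, add_comm]
  congr 1
  refine Finset.sum_congr rfl fun e _ => ?_
  rw [smul_eq_mul, mul_comm]
  congr 2
  funext j
  simp [Pi.single_apply, eq_comm]

/-- Lemma 3.4: if the cut polytope of a finite simple graph `G` is compressed, then so is the
cut polytope of the subgraph induced on any subset `W` of the vertices. -/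
theorem cutPolytope_induce_compressed
    {V : Type*} [Fintype V] (G : SimpleGraph V) (W : Set V)
    (h : IsCompressed (Set.range (cutVec G))) :
    IsCompressed (Set.range (cutVec (G.induce W))) := by

  classical
  have := Fintype.ofFinite G.edgeSet
  obtain ⟨N, π, hinj, hvert, himg⟩ := h
  have hspan := affineSpan_range_cutVec G
  have hπinj : Function.Injective π := π.injective_of_injOn_of_interior_nonempty
    (interior_convexHull_nonempty_iff_affineSpan_eq_top.2 hspan) hinj
  let g : Fin N → (G.edgeSet → ℝ) →ᵃ[ℝ] ℝ := fun i =>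
    (LinearMap.proj (R := ℝ) (φ := fun _ : Fin N => ℝ) i).toAffineMap.comp π
  let c : Fin N → G.edgeSet → ℝ := fun i e => (g i).linear (Pi.single e 1)
  have hg : ∀ i x, π x i = g i 0 + ∑ e, c i e * x e := fun i x => (g i).apply_eq_sum_pi x
  have h01 : ∀ i S, π (cutVec G S) i = 0 ∨ π (cutVec G S) i = 1 := fun i S =>
    hvert _ ⟨subset_convexHull ℝ _ ⟨S, rfl⟩, AddSubgroup.subset_closure ⟨S, rfl⟩⟩ i
  let I := {i : Fin N // ∀ e ∉ Set.range (induceEdge G W), c i e = 0}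
  refine isCompressed_of_affine_family (ι := I) ?_
    (fun i => (g i.1).comp (extendByHalf G W)) ?_ ?_
  · rintro _ ⟨S, rfl⟩ e
    exact cutVec_eq_zero_or_one _ S e
  · rintro ⟨i, hi⟩ _ ⟨S, rfl⟩
    have : π (extendByHalf G W (cutVec (G.induce W) S)) i
        = π (cutVec G (Subtype.val '' S)) i := by
      rw [hg, hg]
      congr 1
      refine Finset.sum_congr rfl fun e _ => ?_
      by_cases he : e ∈ Set.range (induceEdge G W)
      · obtain ⟨e, rfl⟩ := he
        rw [extendByHalf_induceEdge, cutVec_induceEdge,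
          Set.preimage_image_eq _ Subtype.val_injective]
      · rw [hi e he, zero_mul, zero_mul]
    change π (extendByHalf G W (cutVec (G.induce W) S)) i = 0 ∨
      π (extendByHalf G W (cutVec (G.induce W) S)) i = 1
    rw [this]
    exact h01 i _
  · intro x hx hgood
    have hbox : ∀ e, extendByHalf G W x e ∈ Set.Icc (0 : ℝ) 1 := by
      intro e
      by_cases he : e ∈ Set.range (induceEdge G W)
      · obtain ⟨e, rfl⟩ := he
        rw [extendByHalf_induceEdge]
        exact hx e
      · rw [extendByHalf_of_notMem G W x he]
        norm_num
    have hmem : π (extendByHalf G W x) ∈ π '' convexHull ℝ (Set.range (cutVec G)) := by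
      rw [himg]
      refine ⟨fun i => ?_, ?_⟩
      · by_cases hi : ∀ e ∉ Set.range (induceEdge G W), c i e = 0
        · exact hgood ⟨i, hi⟩
        · push Not at hi
          obtain ⟨e, he, hce⟩ := hi
          obtain ⟨v, hv, hvW⟩ := exists_mem_notMem_of_notMem_range_induceEdge G W he
          rw [hg]
          refine affine_mem_Icc_of_half_at_vertex G _ _ (fun S => ?_) hv hce hbox fun e' he' =>
            extendByHalf_of_notMem G W x (notMem_range_induceEdge G W he' hvW)
          rw [← hg]
          exact h01 i S
      · rw [← AffineSubspace.map_span, affineSpan_convexHull, hspan]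
        exact ⟨_, trivial, rfl⟩
    obtain ⟨p, hp, hpx⟩ := hmem
    rw [hπinj hpx] at hp
    have hrestrict : LinearMap.funLeft ℝ ℝ (induceEdge G W) (extendByHalf G W x) = x :=
      funext fun e => extendByHalf_induceEdge G W x e
    rw [← hrestrict]
    have hmap := Set.mem_image_of_mem (LinearMap.funLeft ℝ ℝ (induceEdge G W)) hp
    rw [LinearMap.image_convexHull] at hmap
    refine convexHull_mono ?_ hmap
    rintro _ ⟨_, ⟨S, rfl⟩, rfl⟩
    exact ⟨Subtype.val ⁻¹' S, funext fun e => (cutVec_induceEdge G W S e).symm⟩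
end
end

section
/- Let A ∈ ℤ^{d×n} be a homogeneous integer matrix with columns A₁,…,A_n, i.e. there exists w ∈ ℝ^d with wᵀA_j = 1 for all j. Let P_A = conv{A₁,…,A_n} and let 𝓛 be the subgroup of ℤ^d generated by A₁,…,A_n. Then the following are equivalent: (i) for every i ∈ {1,…,n} and every IP-feasible b ∈ ℤ^d, sup{x_i : x ∈ ℝ^n, x ≥ 0, Ax = b} = sup{x_i : x ∈ ℕ^n, Ax = b}; (ii) P_A is compressed, i.e. there exist N ∈ ℕ and an affine map π : ℝ^d → ℝ^N that is injective on P_A, maps every point of P_A ∩ 𝓛 into {0,1}^N, and satisfies π(P_A) = [0,1]^N ∩ affineSpan_ℝ(π(P_A)). (Theorem 4.6 of the paper, with 'compressed' expressed via the paper's Theorem 2.4 characterization (3).) -/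
noncomputable section

/-- The `j`-th column of the integer matrix `A`, viewed as a point of `ℝ^d`. -/
def col {d n : ℕ} (A : Matrix (Fin d) (Fin n) ℤ) (j : Fin n) : Fin d → ℝ :=
  fun i => (A i j : ℝ)

/-- `b` is IP-feasible for `A`: `b = Ax` for some `x ∈ ℕ^n`. -/
def IPFeasible {d n : ℕ} (A : Matrix (Fin d) (Fin n) ℤ) (b : Fin d → ℤ) : Prop :=
  ∃ x : Fin n → ℕ, ∀ i, ∑ j, A i j * (x j : ℤ) = b i

/-- The optimal value `LP⁺_{i₀}(A,b)` of the linear programming relaxation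
`max x_{i₀}` over `{x ∈ ℝ^n : x ≥ 0, Ax = b}`. -/
noncomputable def LPval {d n : ℕ} (A : Matrix (Fin d) (Fin n) ℤ) (b : Fin d → ℤ)
    (i₀ : Fin n) : ℝ :=
  sSup {t : ℝ | ∃ x : Fin n → ℝ, (∀ j, 0 ≤ x j) ∧
    (∀ i, ∑ j, (A i j : ℝ) * x j = (b i : ℝ)) ∧ t = x i₀}

/-- The optimal value `IP⁺_{i₀}(A,b)` of the integer program
`max x_{i₀}` over `{x ∈ ℕ^n : Ax = b}`. -/
noncomputable def IPval {d n : ℕ} (A : Matrix (Fin d) (Fin n) ℤ) (b : Fin d → ℤ)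
    (i₀ : Fin n) : ℝ :=
  sSup {t : ℝ | ∃ x : Fin n → ℕ, (∀ i, ∑ j, A i j * (x j : ℤ) = b i) ∧ t = (x i₀ : ℝ)}

section Coefficients

variable {V : Type*} [AddCommGroup V] [Module ℝ V] {n : ℕ} {a : Fin n → V}

local notation "S" => Fintype.linearCombination ℝ a

theorem mem_convexHull_range_iff {v : V} :
    v ∈ convexHull ℝ (Set.range a) ↔
      ∃ c : Fin n → ℝ, (∀ j, 0 ≤ c j) ∧ ∑ j, c j = 1 ∧ S c = v := by
  have h : convexHull ℝ (Set.range a) = S '' stdSimplex ℝ (Fin n) := by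
    rw [← convexHull_rangle_single_eq_stdSimplex, LinearMap.image_convexHull, ← Set.range_comp]
    congr 2
    ext j
    simp [Fintype.linearCombination_apply_single]
  rw [h]
  simp [stdSimplex, and_assoc]

theorem mem_affineSpan_range_iff {v : V} :
    v ∈ affineSpan ℝ (Set.range a) ↔ ∃ c : Fin n → ℝ, ∑ j, c j = 1 ∧ S c = v := by
  constructor
  · intro h
    obtain ⟨c, hc, rfl⟩ := eq_affineCombination_of_mem_affineSpan_of_fintype h
    exact ⟨c, hc, by
      rw [Finset.affineCombination_eq_linear_combination _ _ _ hc, Fintype.linearCombination_apply]⟩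
  · rintro ⟨c, hc, rfl⟩
    rw [Fintype.linearCombination_apply,
      ← Finset.affineCombination_eq_linear_combination _ _ _ hc]
    exact affineCombination_mem_affineSpan hc a

theorem map_linearCombination {F : Type*} [AddCommGroup F] [Module ℝ F] (f : V →ₗ[ℝ] F)
    (c : Fin n → ℝ) : f (S c) = ∑ j, c j • f (a j) := by
  simp [Fintype.linearCombination_apply]

theorem sum_eq_of_homogeneous {W : V →ₗ[ℝ] ℝ} (hW : ∀ j, W (a j) = 1) (c : Fin n → ℝ) :
    W (S c) = ∑ j, c j := by
  simp [map_linearCombination, hW]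

/-- A linear map that is injective on a polytope is injective on the directions of its
affine span. -/
theorem linearCombination_eq_zero_of_injOn {F : Type*} [AddCommGroup F] [Module ℝ F]
    {p : V →ₗ[ℝ] F} (hp : Set.InjOn p (convexHull ℝ (Set.range a)))
    {c : Fin n → ℝ} (hc : ∑ j, c j = 0) (h : p (S c) = 0) : S c = 0 := by
  set s := ∑ j, (c j)⁺ with hs
  have hsplit : c = (fun j => (c j)⁺) - fun j => (c j)⁻ := by
    ext j; simp
  have hs' : ∑ j, (c j)⁻ = s := by
    have : ∑ j, ((c j)⁺ - (c j)⁻) = 0 := by simpa using hc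
    rw [Finset.sum_sub_distrib] at this
    linarith
  have hs0 : 0 ≤ s := Finset.sum_nonneg fun j _ => posPart_nonneg _
  rcases hs0.eq_or_lt with h0 | hpos
  · have h1 : ∀ j, (c j)⁺ = 0 := by
      have := (Finset.sum_eq_zero_iff_of_nonneg fun j _ => posPart_nonneg (c j)).1
        (hs.symm.trans h0.symm)
      simpa using this
    have h2 : ∀ j, (c j)⁻ = 0 := by
      have := (Finset.sum_eq_zero_iff_of_nonneg fun j _ => negPart_nonneg (c j)).1
        (hs'.trans h0.symm)
      simpa using this
    have : c = 0 := by
      rw [hsplit]; ext j; simp only [Pi.sub_apply, h1, h2]; simp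
    simp [this]
  · have key : S (s⁻¹ • fun j => (c j)⁺) = S (s⁻¹ • fun j => (c j)⁻) := by
      apply hp
      · refine mem_convexHull_range_iff.2 ⟨_, fun j => ?_, ?_, rfl⟩
        · exact mul_nonneg (inv_nonneg.2 hs0) (posPart_nonneg _)
        · simp only [Pi.smul_apply, smul_eq_mul, ← Finset.mul_sum]
          exact inv_mul_cancel₀ hpos.ne'
      · refine mem_convexHull_range_iff.2 ⟨_, fun j => ?_, ?_, rfl⟩
        · exact mul_nonneg (inv_nonneg.2 hs0) (negPart_nonneg _)
        · simp only [Pi.smul_apply, smul_eq_mul, ← Finset.mul_sum, hs']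
          exact inv_mul_cancel₀ hpos.ne'
      · rw [hsplit, map_sub, map_sub, sub_eq_zero] at h
        simp only [map_smul, h]
    rw [map_smul, map_smul] at key
    have := smul_right_injective V (inv_ne_zero hpos.ne') key
    rw [hsplit, map_sub, this, sub_self]

end Coefficients

section ZeroOneFunctionals

variable {V : Type*} [AddCommGroup V] [Module ℝ V] {n N : ℕ} {a : Fin n → V}
  {W : V →ₗ[ℝ] ℝ} {p : V →ₗ[ℝ] (Fin N → ℝ)}

local notation "S" => Fintype.linearCombination ℝ a

/-- The cone over a polytope that `p` maps injectively onto a slice of the unit cube is cut out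
by the inequalities `0 ≤ p k ≤ W`. -/
theorem exists_nonneg_of_bounds
    (hp : Set.InjOn p (convexHull ℝ (Set.range a)))
    (hsurj : ∀ c : Fin n → ℝ, ∑ j, c j = 1 → p (S c) ∈ stdCube N →
      ∃ q ∈ convexHull ℝ (Set.range a), p q = p (S c))
    {c : Fin n → ℝ} (hc : 0 ≤ ∑ j, c j) (h0 : ∀ k, 0 ≤ p (S c) k)
    (h1 : ∀ k, p (S c) k ≤ ∑ j, c j) :
    ∃ x : Fin n → ℝ, (∀ j, 0 ≤ x j) ∧ S x = S c := by
  rcases hc.eq_or_lt with hm | hm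
  · refine ⟨0, fun j => le_rfl, ?_⟩
    rw [linearCombination_eq_zero_of_injOn hp hm.symm, map_zero]
    ext k
    exact le_antisymm ((h1 k).trans hm.ge) (h0 k)
  · set m := ∑ j, c j with hm'
    have hsum : ∑ j, (m⁻¹ • c) j = 1 := by
      simp only [Pi.smul_apply, smul_eq_mul, ← Finset.mul_sum]
      exact inv_mul_cancel₀ hm.ne'
    obtain ⟨q, hq, hpq⟩ := hsurj (m⁻¹ • c) hsum (fun k => by
      simp only [map_smul, Pi.smul_apply, smul_eq_mul]
      refine ⟨mul_nonneg (inv_nonneg.2 hc) (h0 k), ?_⟩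
      rw [inv_mul_le_iff₀ hm, mul_one]
      exact h1 k)
    obtain ⟨x, hx0, hx1, rfl⟩ := mem_convexHull_range_iff.1 hq
    have h := linearCombination_eq_zero_of_injOn hp (c := x - m⁻¹ • c)
      (by simp only [Pi.sub_apply, Finset.sum_sub_distrib, hx1, hsum, sub_self])
      (by rw [map_sub, map_sub, hpq, sub_self])
    refine ⟨m • x, fun j => mul_nonneg hc (hx0 j), ?_⟩
    rw [map_sub, sub_eq_zero, map_smul] at h
    rw [map_smul, h, smul_inv_smul₀ hm.ne']

theorem exists_nonneg_sub_single
    (hW : ∀ j, W (a j) = 1) (h01 : ∀ j k, p (a j) k = 0 ∨ p (a j) k = 1)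
    (hp : Set.InjOn p (convexHull ℝ (Set.range a)))
    (hsurj : ∀ c : Fin n → ℝ, ∑ j, c j = 1 → p (S c) ∈ stdCube N →
      ∃ q ∈ convexHull ℝ (Set.range a), p q = p (S c))
    {z : Fin n → ℤ} {x : Fin n → ℝ} (hx : ∀ j, 0 ≤ x j) (hxz : S x = S (fun j => (z j : ℝ)))
    {i : Fin n} (hi : 0 < x i) :
    ∃ x' : Fin n → ℝ, (∀ j, 0 ≤ x' j) ∧ S x' = S (fun j => (z j : ℝ)) - a i := by
  have hsum : ∑ j, x j = ∑ j, (z j : ℝ) := by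
    rw [← sum_eq_of_homogeneous hW, ← sum_eq_of_homogeneous hW, hxz]
  have hle : ∀ y : Fin n → ℝ, (∀ j, 0 ≤ y j) → y i ≤ ∑ j, y j := fun y hy =>
    Finset.single_le_sum (fun j _ => hy j) (Finset.mem_univ i)
  have hpos : ∀ t : ℤ, (0 : ℝ) < t → (1 : ℝ) ≤ t := fun t ht => by
    exact_mod_cast Int.add_one_le_iff.2 (Int.cast_pos.1 ht)
  have hm : (1 : ℝ) ≤ ∑ j, (z j : ℝ) := by
    have := hpos (∑ j, z j) (by push_cast; rw [← hsum]; exact hi.trans_le (hle x hx))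
    exact_mod_cast this
  have hpS : ∀ k (y : Fin n → ℝ), p (S y) k = ∑ j, y j * p (a j) k := fun k y => by
    simp [map_linearCombination]
  have hsub : S ((fun j => (z j : ℝ)) - Pi.single i 1) = S (fun j => (z j : ℝ)) - a i := by
    rw [map_sub, Fintype.linearCombination_apply_single, one_smul]
  have hsubsum : ∑ j, ((fun j => (z j : ℝ)) - Pi.single i 1 : Fin n → ℝ) j = ∑ j, (z j : ℝ) - 1 := by
    simp [Finset.sum_sub_distrib]
  rw [← hsub]
  have hInt : ∀ k, ∃ t : ℤ, p (S fun j => (z j : ℝ)) k = t := fun k => by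
    have : ∀ j, ∃ e : ℤ, p (a j) k = e := fun j => by
      rcases h01 j k with h | h
      · exact ⟨0, by simp [h]⟩
      · exact ⟨1, by simp [h]⟩
    choose e he using this
    exact ⟨∑ j, z j * e j, by rw [hpS]; push_cast; simp [he]⟩
  have hcube : ∀ j k, 0 ≤ p (a j) k ∧ p (a j) k ≤ 1 := fun j k => by
    rcases h01 j k with h | h <;> simp [h]
  have hbounds : ∀ k, 0 ≤ p (S fun j => (z j : ℝ)) k - p (a i) k ∧
      p (S fun j => (z j : ℝ)) k - p (a i) k ≤ ∑ j, (z j : ℝ) - 1 := fun k => by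
    obtain ⟨t, ht⟩ := hInt k
    have e1 : (t : ℝ) = ∑ j, x j * p (a j) k := by rw [← ht, ← hxz, hpS]
    have n1 : ∀ j, 0 ≤ x j * p (a j) k := fun j => mul_nonneg (hx j) (hcube j k).1
    have n2 : ∀ j, 0 ≤ x j * (1 - p (a j) k) := fun j =>
      mul_nonneg (hx j) (sub_nonneg.2 (hcube j k).2)
    have b1 := hle _ n1
    have b2 := hle _ n2
    have e2 : ∑ j, x j * (1 - p (a j) k) = ((∑ j, z j - t : ℤ) : ℝ) := by
      push_cast
      simp only [mul_sub, mul_one, Finset.sum_sub_distrib, hsum, e1]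
    rw [← e1] at b1
    rw [e2] at b2
    rw [ht]
    rcases h01 i k with h | h <;> rw [h] at b1 b2 ⊢
    · have := hpos (∑ j, z j - t) (by linarith)
      push_cast at this
      constructor <;> linarith
    · have := hpos t (by linarith)
      push_cast at b2
      constructor <;> linarith
  refine exists_nonneg_of_bounds hp hsurj (by rw [hsubsum]; linarith) (fun k => ?_) (fun k => ?_)
  · rw [hsub, map_sub]; exact (hbounds k).1
  · rw [hsub, hsubsum, map_sub]; exact (hbounds k).2

theorem exists_nat_solution_ge
    (hW : ∀ j, W (a j) = 1) (h01 : ∀ j k, p (a j) k = 0 ∨ p (a j) k = 1)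
    (hp : Set.InjOn p (convexHull ℝ (Set.range a)))
    (hsurj : ∀ c : Fin n → ℝ, ∑ j, c j = 1 → p (S c) ∈ stdCube N →
      ∃ q ∈ convexHull ℝ (Set.range a), p q = p (S c))
    (i₀ : Fin n) (m : ℕ) (z : Fin n → ℤ) (hz : ∑ j, z j = m)
    {x : Fin n → ℝ} (hx : ∀ j, 0 ≤ x j) (hxz : S x = S (fun j => (z j : ℝ))) :
    ∃ y : Fin n → ℕ, S (fun j => (y j : ℝ)) = S (fun j => (z j : ℝ)) ∧ x i₀ ≤ y i₀ := by
  induction m generalizing z x with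
  | zero =>
    have hsum : ∑ j, x j = 0 := by
      rw [← sum_eq_of_homogeneous hW, hxz, sum_eq_of_homogeneous hW]
      exact_mod_cast hz
    have h0 : x = 0 := by
      ext j
      exact (Finset.sum_eq_zero_iff_of_nonneg fun j _ => hx j).1 hsum j (Finset.mem_univ j)
    refine ⟨0, ?_, by simp [h0]⟩
    rw [← hxz, h0]
    congr 1
    ext j; simp
  | succ m ih =>
    have hsum : ∑ j, x j = m + 1 := by
      rw [← sum_eq_of_homogeneous hW, hxz, sum_eq_of_homogeneous hW]
      exact_mod_cast hz
    obtain ⟨i, x', hx', hxi, hge⟩ : ∃ (i : Fin n) (x' : Fin n → ℝ), (∀ j, 0 ≤ x' j) ∧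
        S x' = S (fun j => (z j : ℝ)) - a i ∧
        x i₀ ≤ x' i₀ + (Pi.single i 1 : Fin n → ℝ) i₀ := by
      by_cases hpos : 0 < x i₀
      · by_cases h1 : 1 ≤ x i₀
        · refine ⟨i₀, x - Pi.single i₀ 1, fun j => ?_, ?_, by simp⟩
          · rcases eq_or_ne j i₀ with rfl | hj
            · simpa using h1
            · simpa [hj] using hx j
          · rw [map_sub, hxz, Fintype.linearCombination_apply_single, one_smul]
        · obtain ⟨x', h0, h⟩ := exists_nonneg_sub_single hW h01 hp hsurj hx hxz hpos
          refine ⟨i₀, x', h0, h, ?_⟩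
          have := h0 i₀
          simp only [Pi.single_eq_same]
          linarith
      · obtain ⟨i, -, hi⟩ : ∃ i ∈ Finset.univ, 0 < x i := by
          apply Finset.exists_lt_of_sum_lt (f := fun _ => (0 : ℝ))
          rw [hsum, Finset.sum_const_zero]
          positivity
        obtain ⟨x', h0, h⟩ := exists_nonneg_sub_single hW h01 hp hsurj hx hxz hi
        refine ⟨i, x', h0, h, (not_lt.1 hpos).trans (add_nonneg (h0 _) ?_)⟩
        rw [Pi.single_apply]
        split_ifs <;> norm_num
    have hzcast : (fun j => ((z - Pi.single i 1 : Fin n → ℤ) j : ℝ)) =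
        (fun j => (z j : ℝ)) - Pi.single i 1 := by
      ext j
      by_cases h : j = i <;> simp [h]
    have hS : S (fun j => ((z - Pi.single i 1 : Fin n → ℤ) j : ℝ)) =
        S (fun j => (z j : ℝ)) - a i := by
      rw [hzcast, map_sub, Fintype.linearCombination_apply_single, one_smul]
    obtain ⟨y, hy, hyge⟩ := ih (z - Pi.single i 1)
      (by simp [Finset.sum_sub_distrib, hz]) hx' (by rw [hxi, hS])
    have hycast : (fun j => ((y + Pi.single i 1 : Fin n → ℕ) j : ℝ)) =
        (fun j => (y j : ℝ)) + Pi.single i 1 := by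
      ext j
      by_cases h : j = i <;> simp [h]
    refine ⟨y + Pi.single i 1, ?_, ?_⟩
    · rw [hycast, map_add, hy, hS, Fintype.linearCombination_apply_single, one_smul,
        sub_add_cancel]
    · have := congrFun hycast i₀
      simp only [Pi.add_apply (M := fun _ => ℝ)] at this
      rw [this]
      linarith

end ZeroOneFunctionals

section SeparatingFunctionals

variable {V : Type*} [AddCommGroup V] [Module ℝ V] {n : ℕ} {a : Fin n → V}

/-- Moving a nonnegative functional in a direction that is negative somewhere, until it vanishes
at one more point. -/
theorem exists_more_zeros_of_neg {ℓ g : V →ₗ[ℝ] ℝ} {v : V} (hℓ : ∀ j, 0 ≤ ℓ (a j))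
    (hv : ℓ v < 0) (hgv : g v ≤ 0) (hg : ∀ j, ℓ (a j) = 0 → g (a j) = 0)
    (hneg : ∃ j, g (a j) < 0) :
    ∃ ℓ' : V →ₗ[ℝ] ℝ, (∀ j, 0 ≤ ℓ' (a j)) ∧ ℓ' v < 0 ∧
      (∀ j, ℓ (a j) = 0 → ℓ' (a j) = 0) ∧ ∃ j, ℓ (a j) ≠ 0 ∧ ℓ' (a j) = 0 := by
  classical
  obtain ⟨j₀, hj₀⟩ := hneg
  obtain ⟨i, hi, hmin⟩ := (Finset.univ.filter fun j => g (a j) < 0).exists_min_image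
    (fun j => ℓ (a j) / -g (a j)) ⟨j₀, by simpa using hj₀⟩
  replace hi : g (a i) < 0 := by simpa using hi
  set s := ℓ (a i) / -g (a i) with hs
  have hs0 : 0 ≤ s := div_nonneg (hℓ i) (neg_nonneg.2 hi.le)
  refine ⟨ℓ + s • g, fun j => ?_, ?_, fun j hj => ?_, i, fun h => hi.ne (hg i h), ?_⟩ <;>
    simp only [LinearMap.add_apply, LinearMap.smul_apply, smul_eq_mul]
  · rcases lt_or_ge (g (a j)) 0 with h | h
    · have := hmin j (by simpa using h)
      rw [le_div_iff₀ (neg_pos.2 h)] at this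
      linarith
    · exact add_nonneg (hℓ j) (mul_nonneg hs0 h)
  · linarith [mul_nonpos_of_nonneg_of_nonpos hs0 hgv]
  · rw [hj, hg j hj, mul_zero, add_zero]
  · have : g (a i) ≠ 0 := hi.ne
    rw [hs]
    field_simp
    ring

theorem exists_more_zeros {ℓ g : V →ₗ[ℝ] ℝ} {v : V} (hℓ : ∀ j, 0 ≤ ℓ (a j))
    (hv : ℓ v < 0) (hg : ∀ j, ℓ (a j) = 0 → g (a j) = 0) {i j : Fin n}
    (hi : ℓ (a i) ≠ 0) (hgi : g (a i) = 0) (hgj : g (a j) ≠ 0) :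
    ∃ ℓ' : V →ₗ[ℝ] ℝ, (∀ j, 0 ≤ ℓ' (a j)) ∧ ℓ' v < 0 ∧
      (∀ j, ℓ (a j) = 0 → ℓ' (a j) = 0) ∧ ∃ j, ℓ (a j) ≠ 0 ∧ ℓ' (a j) = 0 := by
  wlog hgv : g v ≤ 0 generalizing g
  · refine this (g := -g) (fun j hj => ?_) ?_ ?_ ?_
    · simp [hg j hj]
    · simp [hgi]
    · simpa using hgj
    · simpa using (not_le.1 hgv).le
  by_cases hneg : ∃ k, g (a k) < 0
  · exact exists_more_zeros_of_neg hℓ hv hgv hg hneg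
  · push Not at hneg
    rcases hgv.eq_or_lt with h0 | hlt
    · refine exists_more_zeros_of_neg (g := -g) hℓ hv (by simp [h0])
        (fun k hk => by simp [hg k hk]) ⟨j, ?_⟩
      simpa using (hneg j).lt_of_ne' hgj
    · exact ⟨g, hneg, hlt, hg, i, hi, hgi⟩

/-- A functional separating `v` from the cone over `a` can be chosen so that its zeros among the
`a j` span a hyperplane in the span of all `a j`. -/
theorem exists_facet_functional {v : V} (ℓ : V →ₗ[ℝ] ℝ) (hℓ : ∀ j, 0 ≤ ℓ (a j))
    (hv : ℓ v < 0) :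
    ∃ ℓ' : V →ₗ[ℝ] ℝ, (∀ j, 0 ≤ ℓ' (a j)) ∧ ℓ' v < 0 ∧
      ∀ i j, 0 < ℓ' (a i) →
        a j - (ℓ' (a j) / ℓ' (a i)) • a i ∈ Submodule.span ℝ (a '' {k | ℓ' (a k) = 0}) := by
  classical
  induction hm : (Finset.univ.filter fun j => ℓ (a j) ≠ 0).card using Nat.strong_induction_on
    generalizing ℓ with
  | _ m ih =>
    by_cases hspan : ∀ i j, 0 < ℓ (a i) →
        a j - (ℓ (a j) / ℓ (a i)) • a i ∈ Submodule.span ℝ (a '' {k | ℓ (a k) = 0})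
    · exact ⟨ℓ, hℓ, hv, hspan⟩
    push Not at hspan
    obtain ⟨i, j, hi, hij⟩ := hspan
    obtain ⟨g, hg, hker⟩ := Submodule.exists_le_ker_of_notMem hij
    have hg0 : ∀ k, ℓ (a k) = 0 → g (a k) = 0 := fun k hk =>
      hker (Submodule.subset_span ⟨k, hk, rfl⟩)
    obtain ⟨ℓ', h1, h2, h3, k, hk, hk'⟩ := exists_more_zeros (i := i) (j := j)
      (g := g - (g (a i) / ℓ (a i)) • ℓ) hℓ hv
      (fun k hk => by simp [hg0 k hk, hk]) hi.ne' (by simp [hi.ne']) (by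
        simp only [map_sub, map_smul, smul_eq_mul] at hg
        simp only [LinearMap.sub_apply, LinearMap.smul_apply, smul_eq_mul]
        convert hg using 2
        ring)
    refine ih _ ?_ ℓ' h1 h2 rfl
    rw [← hm]
    refine Finset.card_lt_card ⟨fun l hl => ?_, fun hsub => ?_⟩
    · simp only [Finset.mem_filter, Finset.mem_univ, true_and] at hl ⊢
      exact fun h => hl (h3 l h)
    · have := hsub (by simpa using hk : k ∈ Finset.univ.filter fun j => ℓ (a j) ≠ 0)
      simp [hk'] at this

theorem exists_zero_one_functional {v : V} (ℓ : V →ₗ[ℝ] ℝ) (hℓ : ∀ j, 0 ≤ ℓ (a j))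
    (hv : ℓ v < 0)
    (hratio : ∀ ℓ : V →ₗ[ℝ] ℝ, (∀ j, 0 ≤ ℓ (a j)) → ∀ i j, 0 < ℓ (a i) → 0 < ℓ (a j) →
      a j - (ℓ (a j) / ℓ (a i)) • a i ∈ Submodule.span ℝ (a '' {k | ℓ (a k) = 0}) →
      ℓ (a i) ≤ ℓ (a j)) :
    ∃ ℓ' : V →ₗ[ℝ] ℝ, (∀ j, ℓ' (a j) = 0 ∨ ℓ' (a j) = 1) ∧ ℓ' v < 0 := by
  obtain ⟨f, hf, hfv, hspan⟩ := exists_facet_functional ℓ hℓ hv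
  by_cases h : ∃ i, 0 < f (a i)
  · obtain ⟨i, hi⟩ := h
    refine ⟨(f (a i))⁻¹ • f, fun j => ?_, ?_⟩
    · rcases (hf j).eq_or_lt with hj | hj
      · left; simp [← hj]
      · right
        have := le_antisymm (hratio f hf i j hi hj (hspan i j hi))
          (hratio f hf j i hj hi (hspan j i hj))
        simp [← this, hi.ne']
    · simpa using mul_neg_of_pos_of_neg (inv_pos.2 hi) hfv
  · push Not at h
    exact ⟨f, fun j => Or.inl (le_antisymm (h j) (hf j)), hfv⟩

end SeparatingFunctionals

/-- If every point of the affine span outside the polytope is cut off by a functional with values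
`0` and `1` on the generators, then the polytope is compressed. -/
theorem isCompressed_of_separating {d n : ℕ} {a : Fin n → Fin d → ℝ}
    (hsep : ∀ v ∈ affineSpan ℝ (Set.range a), v ∉ convexHull ℝ (Set.range a) →
      ∃ ℓ : (Fin d → ℝ) →ₗ[ℝ] ℝ, (∀ j, ℓ (a j) = 0 ∨ ℓ (a j) = 1) ∧ ℓ v < 0) :
    IsCompressed (Set.range a) := by
  classical
  have hex : ∀ ε : Fin n → Bool, ∃ ℓ : (Fin d → ℝ) →ₗ[ℝ] ℝ,
      (∀ j, ℓ (a j) = 0 ∨ ℓ (a j) = 1) ∧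
      ((∃ ℓ' : (Fin d → ℝ) →ₗ[ℝ] ℝ, ∀ j, ℓ' (a j) = if ε j then 1 else 0) →
        ∀ j, ℓ (a j) = if ε j then 1 else 0) := fun ε => by
    by_cases h : ∃ ℓ' : (Fin d → ℝ) →ₗ[ℝ] ℝ, ∀ j, ℓ' (a j) = if ε j then 1 else 0
    · obtain ⟨ℓ, hℓ⟩ := h
      refine ⟨ℓ, fun j => ?_, fun _ => hℓ⟩
      rw [hℓ]
      split_ifs <;> simp
    · exact ⟨0, fun j => Or.inl rfl, fun h' => absurd h' h⟩
  choose ℓ h01 hℓ using hex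
  have hnn : ∀ ε, ∀ v ∈ convexHull ℝ (Set.range a), 0 ≤ ℓ ε v ∧ ℓ ε v ≤ 1 := by
    intro ε v hv
    obtain ⟨c, hc, hc1, rfl⟩ := mem_convexHull_range_iff.1 hv
    have h : ∀ j, 0 ≤ ℓ ε (a j) ∧ ℓ ε (a j) ≤ 1 := fun j => by
      rcases h01 ε j with h | h <;> simp [h]
    rw [map_linearCombination]
    refine ⟨Finset.sum_nonneg fun j _ => mul_nonneg (hc j) (h j).1, ?_⟩
    rw [← hc1]
    exact Finset.sum_le_sum fun j _ => mul_le_of_le_one_right (hc j) (h j).2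
  have hmem : ∀ v ∈ affineSpan ℝ (Set.range a), (∀ ε, 0 ≤ ℓ ε v) →
      v ∈ convexHull ℝ (Set.range a) := by
    intro v hv hpos
    by_contra hnot
    obtain ⟨f, hf, hfv⟩ := hsep v hv hnot
    have hfε : ∀ j, f (a j) = if (decide (f (a j) = 1)) then 1 else 0 := fun j => by
      rcases hf j with h | h <;> simp [h]
    obtain ⟨c, -, rfl⟩ := mem_affineSpan_range_iff.1 hv
    have := hpos fun j => decide (f (a j) = 1)
    rw [map_linearCombination] at this hfv
    simp only [hℓ (fun j => decide (f (a j) = 1)) ⟨f, hfε⟩, ← hfε] at this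
    exact hfv.not_ge this
  set e := Fintype.equivFin (Fin n → Bool)
  let π : (Fin d → ℝ) →ₗ[ℝ] (Fin (Fintype.card (Fin n → Bool)) → ℝ) :=
    LinearMap.pi fun k => ℓ (e.symm k)
  have hπ : ∀ v ε, π v (e ε) = ℓ ε v := fun v ε => by simp [π]
  refine ⟨_, π.toAffineMap, ?_, ?_, ?_⟩
  · intro u hu v hv huv
    by_contra hne
    have hline : ∀ s : ℝ, u + s • (u - v) ∈ convexHull ℝ (Set.range a) := fun s => by
      have hspan : ∀ w ∈ convexHull ℝ (Set.range a), w ∈ affineSpan ℝ (Set.range a) :=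
        fun w hw => convexHull_subset_affineSpan _ hw
      refine hmem _ ?_ fun ε => ?_
      · rw [add_comm]
        exact AffineSubspace.vadd_mem_of_mem_direction (Submodule.smul_mem _ s
          (AffineSubspace.vsub_mem_direction (hspan u hu) (hspan v hv))) (hspan u hu)
      · have : ℓ ε u = ℓ ε v := by
          rw [← hπ, ← hπ]; exact congrFun huv _
        rw [map_add, map_smul, map_sub, this, sub_self, smul_zero, add_zero]
        exact (hnn ε v hv).1
    obtain ⟨C, hC⟩ := ((Set.finite_range a).isCompact_convexHull ℝ).isBounded.exists_norm_le
    have hpos : 0 < ‖u - v‖ := norm_pos_iff.2 (sub_ne_zero.2 hne)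
    have h1 := hC _ (hline ((2 * C + 1) / ‖u - v‖))
    have h2 := hC u hu
    have h3 : ‖((2 * C + 1) / ‖u - v‖) • (u - v)‖ = 2 * C + 1 := by
      rw [norm_smul, norm_div, norm_norm, div_mul_cancel₀ _ hpos.ne', Real.norm_eq_abs,
        abs_of_nonneg]
      linarith [norm_nonneg u]
    have h4 := norm_sub_le (u + ((2 * C + 1) / ‖u - v‖) • (u - v)) u
    rw [add_sub_cancel_left, h3] at h4
    linarith
  · rintro v ⟨hv, hvL⟩ k
    have hInt : ∀ f : (Fin d → ℝ) →ₗ[ℝ] ℝ, (∀ j, f (a j) = 0 ∨ f (a j) = 1) →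
        ∃ t : ℤ, f v = t := by
      intro f hf
      clear hv
      induction hvL using AddSubgroup.closure_induction with
      | mem x hx =>
        obtain ⟨j, rfl⟩ := hx
        rcases hf j with h | h
        · exact ⟨0, by simp [h]⟩
        · exact ⟨1, by simp [h]⟩
      | zero => exact ⟨0, by simp⟩
      | add x y _ _ hx hy =>
        obtain ⟨s, hs⟩ := hx
        obtain ⟨t, ht⟩ := hy
        exact ⟨s + t, by simp [hs, ht]⟩
      | neg x _ hx =>
        obtain ⟨s, hs⟩ := hx
        exact ⟨-s, by simp [hs]⟩
    change ℓ (e.symm k) v = 0 ∨ ℓ (e.symm k) v = 1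
    obtain ⟨t, ht⟩ := hInt _ (h01 (e.symm k))
    have hb := hnn (e.symm k) v hv
    rw [ht] at hb ⊢
    have ht0 : 0 ≤ t := by exact_mod_cast hb.1
    have ht1 : t ≤ 1 := by exact_mod_cast hb.2
    rcases (by omega : t = 0 ∨ t = 1) with rfl | rfl <;> simp
  · apply Set.Subset.antisymm
    · rintro _ ⟨v, hv, rfl⟩
      exact ⟨fun k => hnn (e.symm k) v hv, subset_affineSpan ℝ _ ⟨v, hv, rfl⟩⟩
    · rintro y ⟨hy, hyspan⟩
      rw [← AffineSubspace.map_span, affineSpan_convexHull] at hyspan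
      obtain ⟨v, hv, rfl⟩ := hyspan
      refine ⟨v, hmem v hv fun ε => ?_, rfl⟩
      rw [← hπ]
      exact (hy (e ε)).1

section IntegerMatrix

variable {d n : ℕ} {A : Matrix (Fin d) (Fin n) ℤ} {b : Fin d → ℤ} {i₀ : Fin n}
  {W : (Fin d → ℝ) →ₗ[ℝ] ℝ}

local notation "S" => Fintype.linearCombination ℝ (col A)

theorem linearCombination_col_eq_iff {x : Fin n → ℝ} :
    S x = (fun i => (b i : ℝ)) ↔ ∀ i, ∑ j, (A i j : ℝ) * x j = b i := by
  simp [funext_iff, Fintype.linearCombination_apply, col, mul_comm]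

theorem linearCombination_col_cast_eq_iff {x : Fin n → ℕ} :
    S (fun j => (x j : ℝ)) = (fun i => (b i : ℝ)) ↔ ∀ i, ∑ j, A i j * (x j : ℤ) = b i := by
  rw [linearCombination_col_eq_iff]
  exact forall_congr' fun i => by exact_mod_cast Iff.rfl

theorem le_of_feasible (hW : ∀ j, W (col A j) = 1) {x : Fin n → ℝ} (hx : ∀ j, 0 ≤ x j)
    (hxb : S x = fun i => (b i : ℝ)) : x i₀ ≤ W fun i => (b i : ℝ) := by
  rw [← hxb, sum_eq_of_homogeneous hW]
  exact Finset.single_le_sum (fun j _ => hx j) (Finset.mem_univ i₀)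

theorem le_LPval (hW : ∀ j, W (col A j) = 1) {x : Fin n → ℝ} (hx : ∀ j, 0 ≤ x j)
    (hxb : S x = fun i => (b i : ℝ)) : x i₀ ≤ LPval A b i₀ := by
  refine le_csSup ⟨W fun i => (b i : ℝ), ?_⟩ ⟨x, hx, linearCombination_col_eq_iff.1 hxb, rfl⟩
  rintro _ ⟨y, hy, hyb, rfl⟩
  exact le_of_feasible hW hy (linearCombination_col_eq_iff.2 hyb)

theorem le_IPval (hW : ∀ j, W (col A j) = 1) {x : Fin n → ℕ}
    (hxb : S (fun j => (x j : ℝ)) = fun i => (b i : ℝ)) : (x i₀ : ℝ) ≤ IPval A b i₀ := by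
  refine le_csSup ⟨W fun i => (b i : ℝ), ?_⟩ ⟨x, linearCombination_col_cast_eq_iff.1 hxb, rfl⟩
  rintro _ ⟨y, hyb, rfl⟩
  exact le_of_feasible (x := fun j => (y j : ℝ)) hW (fun j => Nat.cast_nonneg _)
    (linearCombination_col_cast_eq_iff.2 hyb)

theorem LPval_eq_IPval_of_isCompressed (hW : ∀ j, W (col A j) = 1)
    (hc : IsCompressed (Set.range (col A))) (hb : IPFeasible A b) :
    LPval A b i₀ = IPval A b i₀ := by
  obtain ⟨N, π, hinj, h01, himg⟩ := hc
  obtain ⟨z, hz⟩ := hb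
  have hzb := linearCombination_col_cast_eq_iff.2 hz
  let p : (Fin d → ℝ) →ₗ[ℝ] (Fin N → ℝ) := π.linear + W.smulRight (π 0)
  have hp : ∀ v, W v = 1 → p v = π v := fun v hv => by
    rw [AffineMap.decomp π]
    simp [p, hv]
  have hWP : ∀ v ∈ affineSpan ℝ (Set.range (col A)), W v = 1 := fun v hv => by
    obtain ⟨c, hc, rfl⟩ := mem_affineSpan_range_iff.1 hv
    rw [sum_eq_of_homogeneous hW, hc]
  have hpP : ∀ v ∈ convexHull ℝ (Set.range (col A)), p v = π v := fun v hv =>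
    hp v (hWP v (convexHull_subset_affineSpan _ hv))
  have hp01 : ∀ j k, p (col A j) k = 0 ∨ p (col A j) k = 1 := fun j k => by
    have hj : col A j ∈ convexHull ℝ (Set.range (col A)) := subset_convexHull ℝ _ ⟨j, rfl⟩
    rw [hpP _ hj]
    exact h01 _ ⟨hj, AddSubgroup.subset_closure ⟨j, rfl⟩⟩ k
  have hpinj : Set.InjOn p (convexHull ℝ (Set.range (col A))) := fun u hu v hv h =>
    hinj hu hv (by rwa [← hpP u hu, ← hpP v hv])
  have hsurj : ∀ c : Fin n → ℝ, ∑ j, c j = 1 → p (S c) ∈ stdCube N →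
      ∃ q ∈ convexHull ℝ (Set.range (col A)), p q = p (S c) := by
    intro c hc hcube
    have hmem : S c ∈ affineSpan ℝ (Set.range (col A)) := mem_affineSpan_range_iff.2 ⟨c, hc, rfl⟩
    rw [hp _ (hWP _ hmem)] at hcube ⊢
    have : π (S c) ∈ π '' convexHull ℝ (Set.range (col A)) := by
      rw [himg]
      refine ⟨hcube, ?_⟩
      rw [← AffineSubspace.map_span, affineSpan_convexHull]
      exact ⟨_, hmem, rfl⟩
    obtain ⟨q, hq, hqc⟩ := this
    exact ⟨q, hq, (hpP q hq).trans hqc⟩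
  apply le_antisymm
  · refine csSup_le ⟨_, fun j => (z j : ℝ), fun j => Nat.cast_nonneg _,
      linearCombination_col_eq_iff.1 hzb, rfl⟩ ?_
    rintro _ ⟨x, hx, hxb, rfl⟩
    obtain ⟨y, hy, hxy⟩ := exists_nat_solution_ge hW hp01 hpinj hsurj i₀ (∑ j, z j)
      (fun j => (z j : ℤ)) (by push_cast; rfl) hx
      (by simpa [hzb] using linearCombination_col_eq_iff.2 hxb)
    exact hxy.trans (le_IPval hW (by simpa [hzb] using hy))
  · refine csSup_le ⟨_, z, hz, rfl⟩ ?_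
    rintro _ ⟨x, hxb, rfl⟩
    exact le_LPval (x := fun j => (x j : ℝ)) hW (fun j => Nat.cast_nonneg _)
      (linearCombination_col_cast_eq_iff.2 hxb)

theorem le_of_LPval_eq_IPval (hW : ∀ j, W (col A j) = 1)
    (h : ∀ (i₀ : Fin n) (b : Fin d → ℤ), IPFeasible A b → LPval A b i₀ = IPval A b i₀)
    {ℓ : (Fin d → ℝ) →ₗ[ℝ] ℝ} (hℓ : ∀ j, 0 ≤ ℓ (col A j)) {i j : Fin n}
    (hi : 0 < ℓ (col A i)) (hj : 0 < ℓ (col A j))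
    (hspan : col A j - (ℓ (col A j) / ℓ (col A i)) • col A i ∈
      Submodule.span ℝ (col A '' {k | ℓ (col A k) = 0})) :
    ℓ (col A i) ≤ ℓ (col A j) := by
  classical
  by_contra! hlt
  set r := ℓ (col A j) / ℓ (col A i) with hr
  have hr0 : 0 < r := div_pos hj hi
  obtain ⟨c, hc0, hc⟩ : ∃ c : Fin n → ℝ, (∀ k, ℓ (col A k) ≠ 0 → c k = 0) ∧
      S c = col A j - r • col A i := by
    rw [Finsupp.mem_span_image_iff_linearCombination] at hspan
    obtain ⟨c, hcs, hc⟩ := hspan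
    refine ⟨c, fun k hk => ?_, ?_⟩
    · by_contra hck
      exact hk (hcs (Finsupp.mem_support_iff.2 hck))
    · rw [← hc, Fintype.linearCombination_apply, Finsupp.linearCombination_apply,
        Finsupp.sum_fintype _ _ fun k => zero_smul ℝ (col A k)]
  obtain ⟨K, hK⟩ : ∃ K : ℕ, ∀ k, -c k ≤ K := by
    obtain ⟨M, hM⟩ := (Set.finite_range fun k => -c k).bddAbove
    obtain ⟨K, hK⟩ := exists_nat_ge M
    exact ⟨K, fun k => (hM ⟨k, rfl⟩).trans hK⟩
  let κ : Fin n → ℕ := fun k => if ℓ (col A k) = 0 then K else 0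
  let y : Fin n → ℕ := Pi.single j 1 + κ
  let b : Fin d → ℤ := fun i' => ∑ k, A i' k * (y k : ℤ)
  have hyb : S (fun k => (y k : ℝ)) = fun i' => (b i' : ℝ) :=
    linearCombination_col_cast_eq_iff.2 fun _ => rfl
  have hycast : (fun k => (y k : ℝ)) = Pi.single j 1 + fun k => (κ k : ℝ) := by
    ext k
    by_cases hk : k = j
    · subst hk; simp [y]
    · simp [y, hk]
  have hSy : (fun i' => (b i' : ℝ)) = col A j + S fun k => (κ k : ℝ) := by
    rw [← hyb, hycast, map_add, Fintype.linearCombination_apply_single, one_smul]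
  have hℓb : ℓ (fun i' => (b i' : ℝ)) = ℓ (col A j) := by
    rw [hSy, map_add, map_linearCombination, add_eq_left]
    refine Finset.sum_eq_zero fun k _ => ?_
    by_cases hk : ℓ (col A k) = 0 <;> simp [κ, hk]
  have hLP : r ≤ LPval A b i := by
    have := le_LPval (A := A) (b := b) (i₀ := i) hW
      (x := Pi.single i r + (c + fun k => (κ k : ℝ))) (fun k => ?_) ?_
    · simpa [hc0 i hi.ne', κ, hi.ne'] using this
    · refine add_nonneg ?_ ?_
      · rw [Pi.single_apply]
        split_ifs <;> simp [hr0.le]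
      · by_cases hk : ℓ (col A k) = 0
        · simp only [Pi.add_apply, κ, hk, if_true]
          linarith [hK k]
        · simp [hc0 k hk]
    · rw [map_add, map_add, hc, hSy, Fintype.linearCombination_apply_single]
      abel
  have hIP : IPval A b i ≤ 0 := by
    refine csSup_le ⟨_, y, fun _ => rfl, rfl⟩ ?_
    rintro _ ⟨x, hxb, rfl⟩
    have hx := congrArg ℓ (linearCombination_col_cast_eq_iff.2 hxb)
    rw [hℓb, map_linearCombination] at hx
    have hle : (x i : ℝ) * ℓ (col A i) ≤ ℓ (col A j) := by
      rw [← hx]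
      exact Finset.single_le_sum (f := fun k => (x k : ℝ) • ℓ (col A k))
        (fun k _ => mul_nonneg (Nat.cast_nonneg _) (hℓ k)) (Finset.mem_univ i)
    have hx1 : (x i : ℝ) < 1 := by
      by_contra! h1
      nlinarith
    have : x i = 0 := by
      have : x i < 1 := by exact_mod_cast hx1
      omega
    simp [this]
  have := h i b ⟨y, fun _ => rfl⟩
  linarith

theorem isCompressed_of_LPval_eq_IPval (hW : ∀ j, W (col A j) = 1)
    (h : ∀ (i₀ : Fin n) (b : Fin d → ℤ), IPFeasible A b → LPval A b i₀ = IPval A b i₀) :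
    IsCompressed (Set.range (col A)) := by
  refine isCompressed_of_separating fun v hv hnot => ?_
  obtain ⟨f, u, hfv, hf⟩ := geometric_hahn_banach_point_closed (convex_convexHull ℝ _)
    ((Set.finite_range (col A)).isClosed_convexHull ℝ) hnot
  have hWv : W v = 1 := by
    obtain ⟨c, hc, rfl⟩ := mem_affineSpan_range_iff.1 hv
    rw [sum_eq_of_homogeneous hW, hc]
  refine exists_zero_one_functional (f.toLinearMap - u • W) (fun j => ?_) ?_
    fun ℓ hℓ i j => le_of_LPval_eq_IPval hW h hℓ
  · have := hf _ (subset_convexHull ℝ _ ⟨j, rfl⟩)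
    simpa [hW] using this.le
  · simpa [hWv] using hfv

end IntegerMatrix

/-- Theorem 4.6: for a homogeneous integer matrix `A`, the linear programming relaxation
solves the integer program `max x_i` over `{x ≥ 0 : Ax = b}` for every coordinate `i` and
every IP-feasible right-hand side `b` if and only if the polytope `P_A = conv{A₁,…,A_n}`
is compressed (with respect to the lattice generated by the columns of `A`). -/
theorem lp_eq_ip_iff_compressed
    (d n : ℕ) (A : Matrix (Fin d) (Fin n) ℤ)
    (hhom : ∃ w : Fin d → ℝ, ∀ j : Fin n, ∑ i, w i * col A j i = 1) :
    (∀ (i₀ : Fin n) (b : Fin d → ℤ), IPFeasible A b → LPval A b i₀ = IPval A b i₀) ↔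
      IsCompressed (Set.range (col A)) := by
  obtain ⟨w, hw⟩ := hhom
  let W : (Fin d → ℝ) →ₗ[ℝ] ℝ := ∑ i, w i • LinearMap.proj i
  have hW : ∀ j, W (col A j) = 1 := fun j => by simpa [W] using hw j
  exact ⟨isCompressed_of_LPval_eq_IPval hW, fun hc i₀ b => LPval_eq_IPval_of_isCompressed hW hc⟩
end
end
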